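/- Let d and t be positive integers with d a perfect square. Suppose there exist d/2 orthogonal bases B_1, ..., B_{d/2} of ℝ^d forming a set of mutually unbiased bases, every entry of every vector of every B_j being ±1. Then there exist d²/2 equiangular lines in ℝ^{(t+1)d}: choosing a_j = 1 + d^{1/4}/√t for j = 1,...,t and a_{t+1} = (t+1) − (a_1 + ... + a_t), the d²/2 vectors of the block construction [L(a_1) ... L(a_t) L(a_{t+1})] are real, have equal norm, span d²/2 pairwise distinct one-dimensional subspaces, and any two distinct vectors among them have Euclidean inner product of absolute value (t+1)·√d. -/

import Mathlib

/-- Given `d/2` real MUBs of `ℝ^d` (`d` a perfect square) with all entries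
`±1`, the block construction with `a_j = 1 + d^{1/4}/√t` (j = 1, …, t) and
`a_{t+1} = (t+1) − ∑ a_j` yields `d²/2` equiangular lines in `ℝ^{(t+1)d}`:
the constructed (real) vectors have equal norm, span pairwise distinct one-dimensional
subspaces, and distinct vectors have Euclidean inner product of absolute value
`(t+1)·√d`. -/
theorem half_d_sq_equiangular_lines_from_real_MUBs
    (d t : ℕ) (hd : 0 < d) (ht : 0 < t) (hsq : ∃ s : ℕ, d = s ^ 2)
    (B : Fin (d / 2) → Fin d → Fin d → ℝ)
    (hpm : ∀ j i ℓ, B j i ℓ = 1 ∨ B j i ℓ = -1)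
    (horth : ∀ j : Fin (d / 2), ∀ i i' : Fin d, i ≠ i' →
      ∑ ℓ, B j i ℓ * B j i' ℓ = 0)
    (hmub : ∀ j j' : Fin (d / 2), j ≠ j' → ∀ i i' : Fin d,
      |∑ ℓ, B j i ℓ * B j' i' ℓ| = Real.sqrt d)
    (a : Fin t → ℝ)
    (ha : ∀ j, a j = 1 + (d : ℝ) ^ ((1 : ℝ) / 4) / Real.sqrt t)
    (A : Fin (t + 1) → ℝ) (hA : A = Fin.snoc a ((t + 1 : ℝ) - ∑ j, a j))
    (X : Fin (d / 2) × Fin d → Fin (t + 1) × Fin d → ℝ)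
    (hX : X = fun p z =>
      if z.2 = Fin.castLE (Nat.div_le_self d 2) p.1 then A z.1 * B p.1 p.2 z.2
      else B p.1 p.2 z.2) :
    (∃ N : ℝ, 0 < N ∧ ∀ p, Real.sqrt (∑ z, (X p z) ^ 2) = N) ∧
    (∀ p q : Fin (d / 2) × Fin d, p ≠ q →
      Submodule.span ℝ {X p} ≠ Submodule.span ℝ {X q}) ∧
    (∀ p q : Fin (d / 2) × Fin d, p ≠ q →
      |∑ z, X p z * X q z| = (t + 1) * Real.sqrt d) := by
  have hT : (0:ℝ) < t := by exact_mod_cast ht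
  have hD : (0:ℝ) < d := by exact_mod_cast hd
  set c : ℝ := (d : ℝ) ^ ((1 : ℝ) / 4) with hc
  have hc2 : c ^ 2 = Real.sqrt d := by
    rw [hc, ← Real.rpow_natCast, ← Real.rpow_mul hD.le, Real.sqrt_eq_rpow]
    norm_num
  set u : ℝ := Real.sqrt t with hu
  have hu2 : u ^ 2 = t := Real.sq_sqrt hT.le
  have hu0 : 0 < u := Real.sqrt_pos.mpr hT
  set R : ℝ := Real.sqrt d with hR
  have hR0 : 0 < R := Real.sqrt_pos.mpr hD
  have hsa : ∑ j, a j = t * (1 + c / u) := by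
    simp [ha]
    ring
  have hS1 : ∑ i, A i = t + 1 := by
    rw [hA, Fin.sum_univ_castSucc]
    simp
  have hS2 : ∑ i, A i * A i = (t + 1) + (t + 1) * R := by
    rw [hA, Fin.sum_univ_castSucc]
    simp only [Fin.snoc_castSucc, Fin.snoc_last, hsa]
    simp only [ha, Finset.sum_const, Finset.card_univ, Fintype.card_fin, nsmul_eq_mul]
    rw [← hc2, ← hu2]
    field_simp
    ring
  set e : Fin (d / 2) → Fin d := Fin.castLE (Nat.div_le_self d 2) with he
  have hinj : Function.Injective e := Fin.castLE_injective _
  have hXX : ∀ p q, ∑ z, X p z * X q z = ∑ ℓ, B p.1 p.2 ℓ * B q.1 q.2 ℓ *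
      ∑ i, (if ℓ = e p.1 then A i else 1) * (if ℓ = e q.1 then A i else 1) := by
    intro p q
    rw [Fintype.sum_prod_type_right]
    refine Finset.sum_congr rfl fun ℓ _ => ?_
    rw [Finset.mul_sum]
    refine Finset.sum_congr rfl fun i _ => ?_
    rw [hX]
    dsimp only
    split_ifs <;> ring
  have hsame : ∀ j i i', ∑ z, X (j, i) z * X (j, i') z =
      (t + 1) * ∑ ℓ, B j i ℓ * B j i' ℓ + (t + 1) * R * (B j i (e j) * B j i' (e j)) := by
    intro j i i'
    rw [hXX]
    have : ∀ ℓ, (∑ i, (if ℓ = e j then A i else 1) * (if ℓ = e j then A i else 1))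
        = (t + 1) + if ℓ = e j then (t + 1) * R else 0 := by
      intro ℓ
      split_ifs
      · exact hS2
      · simp
    simp only [this]
    rw [Finset.mul_sum]
    have h2 : (t + 1) * R * (B j i (e j) * B j i' (e j)) =
        ∑ ℓ, if ℓ = e j then (t + 1) * R * (B j i ℓ * B j i' ℓ) else 0 := by
      simp
    rw [h2, ← Finset.sum_add_distrib]
    refine Finset.sum_congr rfl fun ℓ _ => ?_
    split_ifs <;> ring
  have hdiff : ∀ j j' i i', j ≠ j' → ∑ z, X (j, i) z * X (j', i') z =
      (t + 1) * ∑ ℓ, B j i ℓ * B j' i' ℓ := by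
    intro j j' i i' hj
    rw [hXX, Finset.mul_sum]
    refine Finset.sum_congr rfl fun ℓ _ => ?_
    have : (∑ i, (if ℓ = e j then A i else 1) * (if ℓ = e j' then A i else 1)) = (t:ℝ) + 1 := by
      by_cases h1 : ℓ = e j
      · have h2 : ℓ ≠ e j' := fun h => hj (hinj (h1.symm.trans h))
        simp only [if_pos h1, if_neg h2, mul_one, hS1]
      · by_cases h2 : ℓ = e j'
        · simp only [if_neg h1, if_pos h2, one_mul, hS1]
        · simp [h1, h2]
    rw [this]
    ring
  have hB2 : ∀ j i ℓ, B j i ℓ * B j i ℓ = 1 := by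
    intro j i ℓ
    rcases hpm j i ℓ with h | h <;> rw [h] <;> norm_num
  have hnorm : ∀ p, ∑ z, X p z * X p z = (t + 1) * d + (t + 1) * R := by
    rintro ⟨j, i⟩
    rw [hsame]
    simp [hB2]
  have hang : ∀ p q : Fin (d / 2) × Fin d, p ≠ q →
      |∑ z, X p z * X q z| = (t + 1) * R := by
    rintro ⟨j, i⟩ ⟨j', i'⟩ hne
    by_cases hj : j = j'
    · subst hj
      have hi : i ≠ i' := fun h => hne (by rw [h])
      rw [hsame, horth j i i' hi, mul_zero, zero_add, abs_mul, abs_of_pos (by positivity)]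
      have : |B j i (e j) * B j i' (e j)| = 1 := by
        rcases hpm j i (e j) with h | h <;> rcases hpm j i' (e j) with h' | h' <;>
          rw [h, h'] <;> norm_num
      rw [this, mul_one]
    · rw [hdiff j j' i i' hj, abs_mul, hmub j j' hj, abs_of_pos (by positivity)]
  refine ⟨⟨Real.sqrt ((t + 1) * d + (t + 1) * R), by positivity, fun p => ?_⟩, ?_, hang⟩
  · rw [← hnorm p]
    simp only [sq]
  · intro p q hne hspan
    have hmem : X q ∈ Submodule.span ℝ {X p} := by
      rw [hspan]
      exact Submodule.mem_span_singleton_self _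
    obtain ⟨r, hr⟩ := Submodule.mem_span_singleton.mp hmem
    have h1 : ∑ z, X p z * X q z = r * ((t + 1) * d + (t + 1) * R) := by
      rw [← hnorm p, Finset.mul_sum, ← hr]
      refine Finset.sum_congr rfl fun z _ => ?_
      simp only [Pi.smul_apply, smul_eq_mul]
      ring
    have h2 : (t + 1) * d + (t + 1) * R = r ^ 2 * ((t + 1) * d + (t + 1) * R) := by
      conv_lhs => rw [← hnorm q]
      rw [← hnorm p, Finset.mul_sum, ← hr]
      refine Finset.sum_congr rfl fun z _ => ?_
      simp only [Pi.smul_apply, smul_eq_mul]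
      ring
    have hpos : 0 < ((t:ℝ) + 1) * d + (t + 1) * R := by positivity
    have hr2 : r ^ 2 = 1 := by
      have := mul_right_cancel₀ hpos.ne' ((one_mul _).trans h2)
      exact this.symm
    have hr1 : |r| = 1 := by
      rcases sq_eq_sq_iff_eq_or_eq_neg.mp (hr2.trans (one_pow 2).symm) with h | h <;> rw [h] <;> norm_num
    have h3 := hang p q hne
    rw [h1, abs_mul, hr1, abs_of_pos hpos] at h3
    have : 0 < ((t:ℝ) + 1) * d := by positivity
    linarith
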